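/- arXiv:2405.17936 — 2 statements merged into one kernel-verified Lean document; each statement's English description precedes it below -/
import Mathlib

section
/- Let u, v, y, w ∈ ℝ⁸ satisfy Φ₀(u,v,y,w) = 0 (a Cayley-free 4-frame), and set A = ⟨u,y⟩⟨v,w⟩ − ⟨u,w⟩⟨v,y⟩. Then the following identities of 8-forms hold: (ι_u ι_v Φ₀) ∧ (y♭ ∧ w♭) ∧ Φ₀ = −3A · vol, (u♭ ∧ v♭) ∧ (ι_y Φ₀) ∧ (ι_w Φ₀) = −4A · vol, and (ι_u ι_v Φ₀) ∧ (ι_y ι_w Φ₀) ∧ Φ₀ = 6A · vol. -/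
noncomputable section
open scoped RealInnerProductSpace

/-- Euclidean 8-space ℝ⁸. -/
abbrev E8 : Type := EuclideanSpace ℝ (Fin 8)

/-- The alternating 4-form `dx^i ∧ dx^j ∧ dx^k ∧ dx^l` on ℝ⁸, evaluated on four vectors. -/
def dx4 (i j k l : Fin 8) (v : Fin 4 → E8) : ℝ :=
  Matrix.det (Matrix.of fun a b => v b (![i, j, k, l] a))

/-- The Cayley 4-form `Φ₀` on ℝ⁸ (indices written 0-based, i.e. `dx4 0 1 2 3` is `dx¹²³⁴`). -/
def Phi0 (v : Fin 4 → E8) : ℝ :=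
  dx4 0 1 2 3 v + dx4 0 1 4 5 v + dx4 0 1 6 7 v + dx4 0 2 4 6 v
    - dx4 0 2 5 7 v - dx4 0 3 4 7 v - dx4 0 3 5 6 v
    - dx4 1 2 4 7 v - dx4 1 2 5 6 v - dx4 1 3 4 6 v
    + dx4 1 3 5 7 v + dx4 2 3 4 5 v + dx4 2 3 6 7 v + dx4 4 5 6 7 v

/-- The wedge product of a `p`-form and a `q`-form on ℝ⁸ (forms represented as
functions of tuples of vectors), in the determinant convention: for alternating
`f` and `g` this is the usual exterior product, with `dx¹ ∧ ⋯ ∧ dx⁸ = vol`. -/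
def wedge {p q : ℕ} (f : (Fin p → E8) → ℝ) (g : (Fin q → E8) → ℝ)
    (v : Fin (p + q) → E8) : ℝ :=
  ((p.factorial * q.factorial : ℕ) : ℝ)⁻¹ *
    ∑ σ : Equiv.Perm (Fin (p + q)),
      ((Equiv.Perm.sign σ : ℤ) : ℝ) *
        ((f fun i => v (σ (Fin.castAdd q i))) * g fun j => v (σ (Fin.natAdd p j)))

/-- The standard volume form `vol = dx¹ ∧ ⋯ ∧ dx⁸` on ℝ⁸. -/
def vol (v : Fin 8 → E8) : ℝ := Matrix.det (Matrix.of fun a b => v b a)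

/-- The 1-form `u♭ = ⟨u, ·⟩`. -/
def flat (u : E8) (v : Fin 1 → E8) : ℝ := ⟪u, v 0⟫

/-- The contraction 3-form `ι_u Φ₀ = Φ₀(u, ·, ·, ·)`. -/
def iota1 (u : E8) (z : Fin 3 → E8) : ℝ := Phi0 ![u, z 0, z 1, z 2]

/-- The contraction 2-form `ι_u ι_v Φ₀ = Φ₀(v, u, ·, ·)`. -/
def iota2 (u v : E8) (z : Fin 2 → E8) : ℝ := Phi0 ![v, u, z 0, z 1]

open Equiv in
/-- The permutation of `Fin (p + q)` acting blockwise by `τ` and `ρ`. -/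
def blockPerm {p q : ℕ} (τ : Perm (Fin p)) (ρ : Perm (Fin q)) : Perm (Fin (p + q)) :=
  finSumFinEquiv.permCongr (Equiv.sumCongr τ ρ)

section Blocks
open Equiv

variable {p q : ℕ}

@[simp] lemma blockPerm_castAdd (τ : Perm (Fin p)) (ρ : Perm (Fin q)) (i : Fin p) :
    blockPerm τ ρ (Fin.castAdd q i) = Fin.castAdd q (τ i) := by
  simp [blockPerm, Equiv.permCongr_apply]

@[simp] lemma blockPerm_natAdd (τ : Perm (Fin p)) (ρ : Perm (Fin q)) (j : Fin q) :
    blockPerm τ ρ (Fin.natAdd p j) = Fin.natAdd p (ρ j) := by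
  simp [blockPerm, Equiv.permCongr_apply]

lemma sign_blockPerm (τ : Perm (Fin p)) (ρ : Perm (Fin q)) :
    Perm.sign (blockPerm τ ρ) = Perm.sign τ * Perm.sign ρ := by
  simp [blockPerm]

lemma exists_blockPerm (σ : Perm (Fin (p + q)))
    (h : ∀ i : Fin p, ∃ j : Fin p, σ (Fin.castAdd q i) = Fin.castAdd q j) :
    ∃ τ ρ, σ = blockPerm τ ρ := by
  have key : finSumFinEquiv.symm.permCongr σ ∈ (Perm.sumCongrHom (Fin p) (Fin q)).range := by
    apply Perm.mem_sumCongrHom_range_of_perm_mapsTo_inl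
    rintro _ ⟨i, rfl⟩
    obtain ⟨j, hj⟩ := h i
    exact ⟨j, by simp [Equiv.permCongr_apply, hj]⟩
  obtain ⟨⟨τ, ρ⟩, hτ⟩ := key
  refine ⟨τ, ρ, ?_⟩
  ext x
  have := congrArg (fun π => finSumFinEquiv (π (finSumFinEquiv.symm x))) hτ
  simp [Equiv.permCongr_apply] at this
  simp [blockPerm, Equiv.permCongr_apply, this]

lemma blockPerm_injective : Function.Injective
    fun x : Perm (Fin p) × Perm (Fin q) => blockPerm x.1 x.2 := by
  rintro ⟨τ, ρ⟩ ⟨τ', ρ'⟩ h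
  refine Prod.ext (Equiv.ext fun i => ?_) (Equiv.ext fun j => ?_)
  · simpa using congrArg (fun π => π (Fin.castAdd q i)) h
  · simpa using congrArg (fun π => π (Fin.natAdd p j)) h

lemma mul_blockPerm_injective {ι : Type*} {r : ι → Perm (Fin (p + q))}
    (hr : ∀ a b, (∀ i : Fin p, ∃ j : Fin p, r b (Fin.castAdd q i) = r a (Fin.castAdd q j)) →
      a = b) :
    Function.Injective fun x : ι × Perm (Fin p) × Perm (Fin q) =>
      r x.1 * blockPerm x.2.1 x.2.2 := by
  rintro ⟨a, τ, ρ⟩ ⟨b, τ', ρ'⟩ h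
  dsimp only at h
  have hab : a = b := by
    refine hr a b fun i => ⟨τ (τ'⁻¹ i), ?_⟩
    have := congrArg (fun π => π (Fin.castAdd q (τ'⁻¹ i))) h
    simpa using this.symm
  subst hab
  have h' : blockPerm τ ρ = blockPerm τ' ρ' := mul_left_cancel h
  have := @blockPerm_injective p q (τ, ρ) (τ', ρ') h'
  rw [this]

/-- A form on `ℝ⁸`: a function of `n` vectors that is multilinear and alternating. -/
def IsForm {n : ℕ} (f : (Fin n → E8) → ℝ) : Prop :=
  ∃ ω : E8 [⋀^Fin n]→ₗ[ℝ] ℝ, ⇑ω = f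

lemma IsForm.perm {n : ℕ} {f : (Fin n → E8) → ℝ} (hf : IsForm f) (σ : Perm (Fin n))
    (v : Fin n → E8) : f (fun i => v (σ i)) = ((Perm.sign σ : ℤ) : ℝ) * f v := by
  obtain ⟨ω, rfl⟩ := hf
  have := ω.map_perm v σ
  rw [Units.smul_def, zsmul_eq_mul] at this
  exact this

lemma IsForm.add {n : ℕ} {f g : (Fin n → E8) → ℝ} (hf : IsForm f) (hg : IsForm g) :
    IsForm (fun v => f v + g v) := by
  obtain ⟨ω, rfl⟩ := hf
  obtain ⟨η, rfl⟩ := hg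
  exact ⟨ω + η, rfl⟩

lemma IsForm.sub {n : ℕ} {f g : (Fin n → E8) → ℝ} (hf : IsForm f) (hg : IsForm g) :
    IsForm (fun v => f v - g v) := by
  obtain ⟨ω, rfl⟩ := hf
  obtain ⟨η, rfl⟩ := hg
  exact ⟨ω - η, rfl⟩

lemma IsForm.wedge {f : (Fin p → E8) → ℝ} {g : (Fin q → E8) → ℝ}
    (hf : IsForm f) (hg : IsForm g) : IsForm (wedge f g) := by
  obtain ⟨ω, rfl⟩ := hf
  obtain ⟨η, rfl⟩ := hg
  let m : MultilinearMap ℝ (fun _ : Fin (p + q) => E8) ℝ :=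
    ((LinearMap.mul' ℝ ℝ).compMultilinearMap
      (MultilinearMap.domCoprod ω.toMultilinearMap η.toMultilinearMap)).domDomCongr finSumFinEquiv
  refine ⟨((p.factorial * q.factorial : ℕ) : ℝ)⁻¹ • MultilinearMap.alternatization m, ?_⟩
  ext v
  simp only [AlternatingMap.smul_apply, MultilinearMap.alternatization_apply, smul_eq_mul, _root_.wedge]
  congr 1
  refine Finset.sum_congr rfl fun σ _ => ?_
  rw [Units.smul_def, zsmul_eq_mul]
  simp [m]

/-- A wedge product computed from representatives `r` of the blockwise cosets that contribute. -/
lemma wedge_eq_sum {f : (Fin p → E8) → ℝ} {g : (Fin q → E8) → ℝ}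
    (hf : IsForm f) (hg : IsForm g) (v : Fin (p + q) → E8) {ι : Type*} [Fintype ι]
    (r : ι → Perm (Fin (p + q)))
    (hr : ∀ a b, (∀ i : Fin p, ∃ j : Fin p, r b (Fin.castAdd q i) = r a (Fin.castAdd q j)) → a = b)
    (h0 : ∀ σ : Perm (Fin (p + q)), (∀ a τ ρ, σ ≠ r a * blockPerm τ ρ) →
      (f fun i => v (σ (Fin.castAdd q i))) * (g fun j => v (σ (Fin.natAdd p j))) = 0) :
    wedge f g v = ∑ a, ((Perm.sign (r a) : ℤ) : ℝ) *
        ((f fun i => v (r a (Fin.castAdd q i))) * g fun j => v (r a (Fin.natAdd p j))) := by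
  let e : ι × Perm (Fin p) × Perm (Fin q) → Perm (Fin (p + q)) :=
    fun x => r x.1 * blockPerm x.2.1 x.2.2
  have he : Function.Injective e := mul_blockPerm_injective hr
  have hsum := Fintype.sum_of_injective e he
    (fun x => ((Perm.sign (r x.1) : ℤ) : ℝ) *
      ((f fun i => v (r x.1 (Fin.castAdd q i))) * g fun j => v (r x.1 (Fin.natAdd p j))))
    (fun σ => ((Perm.sign σ : ℤ) : ℝ) *
        ((f fun i => v (σ (Fin.castAdd q i))) * g fun j => v (σ (Fin.natAdd p j))))
    (fun σ hσ => by
      rw [h0 σ fun a τ ρ h => hσ ⟨(a, τ, ρ), h.symm⟩, mul_zero])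
    (fun ⟨a, τ, ρ⟩ => by
      have h1 := hf.perm τ (fun i => v (r a (Fin.castAdd q i)))
      have h2 := hg.perm ρ (fun i => v (r a (Fin.natAdd p i)))
      simp only [e, Perm.mul_apply, blockPerm_castAdd, blockPerm_natAdd, h1, h2, Perm.sign_mul,
      sign_blockPerm, Units.val_mul, Int.cast_mul]
      have hτ : ((Perm.sign τ : ℤ) : ℝ) * ((Perm.sign τ : ℤ) : ℝ) = 1 := by
        rcases Int.units_eq_one_or (Perm.sign τ) with h | h <;> simp [h]
      have hρ : ((Perm.sign ρ : ℤ) : ℝ) * ((Perm.sign ρ : ℤ) : ℝ) = 1 := by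
        rcases Int.units_eq_one_or (Perm.sign ρ) with h | h <;> simp [h]
      generalize ((Perm.sign τ : ℤ) : ℝ) = s at *
      generalize ((Perm.sign ρ : ℤ) : ℝ) = t at *
      generalize (f fun i => v (r a (Fin.castAdd q i))) = F
      generalize (g fun i => v (r a (Fin.natAdd p i))) = G
      linear_combination (-(((Perm.sign (r a) : ℤ) : ℝ) * F * G)) * ((t * t) * hτ + hρ))
  rw [wedge, ← hsum, Fintype.sum_prod_type]
  simp only [Finset.sum_const, Finset.card_univ, Fintype.card_prod, Fintype.card_perm,
    Fintype.card_fin, nsmul_eq_mul]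
  rw [← Finset.mul_sum, inv_mul_cancel_left₀]
  exact_mod_cast (Nat.mul_pos p.factorial_pos q.factorial_pos).ne'

/-- A wedge product as a signed sum over a full set of shuffles, given by injective index
functions. -/
lemma wedge_eq_sum_shuffles {f : (Fin p → E8) → ℝ} {g : (Fin q → E8) → ℝ}
    (hf : IsForm f) (hg : IsForm g) (v : Fin (p + q) → E8) {ι : Type*} [Fintype ι]
    (r : ι → Fin (p + q) → Fin (p + q)) (hinj : ∀ a, Function.Injective (r a))
    (s : ι → ℤ)
    (hs : ∀ a, (Perm.sign (Equiv.ofBijective (r a)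
      (Finite.injective_iff_bijective.1 (hinj a))) : ℤ) = s a)
    (hr : ∀ a b, (∀ i : Fin p, ∃ j : Fin p, r b (Fin.castAdd q i) = r a (Fin.castAdd q j)) → a = b)
    (hcard : Fintype.card ι * (p.factorial * q.factorial) = (p + q).factorial) :
    wedge f g v = ∑ a, (s a : ℝ) *
        ((f fun i => v (r a (Fin.castAdd q i))) * g fun j => v (r a (Fin.natAdd p j))) := by
  let R : ι → Perm (Fin (p + q)) := fun a => Equiv.ofBijective (r a)
      (Finite.injective_iff_bijective.1 (hinj a))
  have hR : ∀ a b, (∀ i : Fin p, ∃ j : Fin p,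
      R b (Fin.castAdd q i) = R a (Fin.castAdd q j)) → a = b := hr
  rw [wedge_eq_sum hf hg v R hR]
  · exact Finset.sum_congr rfl fun a _ => by rw [← hs a]; rfl
  · intro σ hσ
    let e : ι × Perm (Fin p) × Perm (Fin q) → Perm (Fin (p + q)) :=
      fun x => R x.1 * blockPerm x.2.1 x.2.2
    have he : Function.Injective e := mul_blockPerm_injective hR
    have hb : Function.Bijective e := by
      rw [Fintype.bijective_iff_injective_and_card]
      exact ⟨he, by simp [Fintype.card_perm, hcard]⟩
    obtain ⟨⟨a, τ, ρ⟩, h⟩ := hb.2 σ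
    exact absurd h.symm (hσ a τ ρ)

end Blocks

section Forms
open Equiv

lemma isForm_dx4 (i j k l : Fin 8) : IsForm (dx4 i j k l) := by
  let L : E8 →ₗ[ℝ] (Fin 4 → ℝ) :=
    LinearMap.pi fun a => (EuclideanSpace.proj (𝕜 := ℝ) (![i, j, k, l] a)).toLinearMap
  refine ⟨Matrix.detRowAlternating.compLinearMap L, ?_⟩
  ext v
  rw [dx4, ← Matrix.det_transpose]
  rfl

lemma isForm_Phi0 : IsForm Phi0 :=
  (((((((((((((isForm_dx4 _ _ _ _).add (isForm_dx4 _ _ _ _)).add (isForm_dx4 _ _ _ _)).add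
    (isForm_dx4 _ _ _ _)).sub (isForm_dx4 _ _ _ _)).sub (isForm_dx4 _ _ _ _)).sub
    (isForm_dx4 _ _ _ _)).sub (isForm_dx4 _ _ _ _)).sub (isForm_dx4 _ _ _ _)).sub
    (isForm_dx4 _ _ _ _)).add (isForm_dx4 _ _ _ _)).add (isForm_dx4 _ _ _ _)).add
    (isForm_dx4 _ _ _ _)).add (isForm_dx4 _ _ _ _)

lemma isForm_iota1 (u : E8) : IsForm (iota1 u) := by
  obtain ⟨ω, hω⟩ := isForm_Phi0
  refine ⟨ω.curryLeft u, ?_⟩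
  ext z
  rw [AlternatingMap.curryLeft_apply_apply, hω, iota1]
  congr 1
  ext i
  fin_cases i <;> rfl

lemma isForm_iota2 (u v : E8) : IsForm (iota2 u v) := by
  obtain ⟨ω, hω⟩ := isForm_Phi0
  refine ⟨(ω.curryLeft v).curryLeft u, ?_⟩
  ext z
  rw [AlternatingMap.curryLeft_apply_apply, AlternatingMap.curryLeft_apply_apply, hω, iota2]
  congr 1
  ext i
  fin_cases i <;> rfl

lemma isForm_flat (u : E8) : IsForm (flat u) :=
  ⟨AlternatingMap.ofSubsingleton ℝ E8 ℝ (0 : Fin 1) (innerₛₗ ℝ u), rfl⟩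

/-- The standard basis vectors of `ℝ⁸`. -/
def stdVec (i : Fin 8) : E8 := EuclideanSpace.single i 1

lemma stdVec_apply (i j : Fin 8) : stdVec i j = if j = i then 1 else 0 := by
  simp [stdVec]

/-- A form of top degree is determined by its value on the standard basis. -/
lemma IsForm.eq_mul_vol {f : (Fin 8 → E8) → ℝ} (hf : IsForm f) (v : Fin 8 → E8) :
    f v = f stdVec * vol v := by
  obtain ⟨ω, rfl⟩ := hf
  let b := (EuclideanSpace.basisFun (Fin 8) ℝ).toBasis
  have hb : ⇑b = stdVec := by
    ext i
    simp [b, stdVec]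
  have hv : b.det v = vol v := by
    rw [Module.Basis.det_apply, vol]
    congr 1
  have := congrArg (fun η => η v) (ω.eq_smul_basis_det b)
  simpa [hb, hv] using this

/-- The wedge product with a coordinate 4-form picks out the complementary coefficient. -/
lemma wedge_dx4_stdVec {f : (Fin 4 → E8) → ℝ} (hf : IsForm f) (π : Perm (Fin 8)) :
    wedge f (dx4 (π 4) (π 5) (π 6) (π 7)) stdVec = ((Perm.sign π : ℤ) : ℝ) *
      f ![stdVec (π 0), stdVec (π 1), stdVec (π 2), stdVec (π 3)] := by
  have hJ : ∀ a : Fin 4, ![π 4, π 5, π 6, π 7] a = π (Fin.natAdd 4 a) := by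
    intro a
    fin_cases a <;> rfl
  have hone : dx4 (π 4) (π 5) (π 6) (π 7) (fun j => stdVec (π (Fin.natAdd 4 j))) = 1 := by
    rw [dx4, ← Matrix.det_one (n := Fin 4)]
    congr 1
    ext a b
    simp only [Matrix.of_apply, hJ, stdVec_apply, Matrix.one_apply, π.injective.eq_iff]
    simp [Fin.ext_iff]
  rw [wedge_eq_sum hf (isForm_dx4 _ _ _ _) stdVec (fun _ : Unit => π) (fun _ _ _ => rfl)]
  · rw [Fintype.sum_unique, hone, mul_one]
    congr 2
    ext i
    fin_cases i <;> rfl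
  · intro σ hσ
    by_contra h
    have hdet := right_ne_zero_of_mul h
    have hrow : ∀ a : Fin 4, ∃ b : Fin 4, (π⁻¹ * σ) (Fin.natAdd 4 b) = Fin.natAdd 4 a := by
      intro a
      by_contra! hb
      refine hdet (Matrix.det_eq_zero_of_row_eq_zero a fun b => ?_)
      rw [Matrix.of_apply, hJ, stdVec_apply, if_neg]
      intro hab
      exact hb b (by rw [Perm.mul_apply, ← hab]; exact π.symm_apply_apply _)
    choose c hc using hrow
    obtain ⟨τ, ρ, hτ⟩ := exists_blockPerm (π⁻¹ * σ) (p := 4) (q := 4) fun i => by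
      induction h : (π⁻¹ * σ) (Fin.castAdd 4 i) using Fin.addCases (m := 4) (n := 4) with
      | left j => exact ⟨j, rfl⟩
      | right j =>
        have := (π⁻¹ * σ).injective (h.trans (hc j).symm)
        have := congrArg Fin.val this
        simp at this
        omega
    exact hσ () τ ρ (by rw [← hτ, mul_inv_cancel_left])

lemma wedge_add_right {p q : ℕ} (f : (Fin p → E8) → ℝ) (g h : (Fin q → E8) → ℝ)
    (v : Fin (p + q) → E8) :
    wedge f (fun z => g z + h z) v = wedge f g v + wedge f h v := by
  simp only [wedge, mul_add, Finset.sum_add_distrib]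

lemma wedge_sub_right {p q : ℕ} (f : (Fin p → E8) → ℝ) (g h : (Fin q → E8) → ℝ)
    (v : Fin (p + q) → E8) :
    wedge f (fun z => g z - h z) v = wedge f g v - wedge f h v := by
  simp only [wedge, mul_sub, Finset.sum_sub_distrib]

lemma wedge_Phi0_stdVec {f : (Fin 4 → E8) → ℝ} (hf : IsForm f) :
    wedge f Phi0 stdVec =
      f ![stdVec 4, stdVec 5, stdVec 6, stdVec 7] + f ![stdVec 2, stdVec 3, stdVec 6, stdVec 7] +
      f ![stdVec 2, stdVec 3, stdVec 4, stdVec 5] + f ![stdVec 1, stdVec 3, stdVec 5, stdVec 7] -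
      f ![stdVec 1, stdVec 3, stdVec 4, stdVec 6] - f ![stdVec 1, stdVec 2, stdVec 5, stdVec 6] -
      f ![stdVec 1, stdVec 2, stdVec 4, stdVec 7] - f ![stdVec 0, stdVec 3, stdVec 5, stdVec 6] -
      f ![stdVec 0, stdVec 3, stdVec 4, stdVec 7] - f ![stdVec 0, stdVec 2, stdVec 5, stdVec 7] +
      f ![stdVec 0, stdVec 2, stdVec 4, stdVec 6] + f ![stdVec 0, stdVec 1, stdVec 6, stdVec 7] +
      f ![stdVec 0, stdVec 1, stdVec 4, stdVec 5] + f ![stdVec 0, stdVec 1, stdVec 2, stdVec 3] := by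
  have key : ∀ r : Fin 8 → Fin 8, ∀ hr : Function.Bijective r, ∀ s : ℤ,
      (Perm.sign (Equiv.ofBijective r hr) : ℤ) = s →
      wedge f (dx4 (r 4) (r 5) (r 6) (r 7)) stdVec =
        s * f ![stdVec (r 0), stdVec (r 1), stdVec (r 2), stdVec (r 3)] := by
    rintro r hr s rfl
    exact wedge_dx4_stdVec hf (Equiv.ofBijective r hr)
  unfold Phi0
  simp only [wedge_add_right, wedge_sub_right]
  have h0 := key ![4, 5, 6, 7, 0, 1, 2, 3] (by decide) 1 (by decide)
  have h1 := key ![2, 3, 6, 7, 0, 1, 4, 5] (by decide) 1 (by decide)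
  have h2 := key ![2, 3, 4, 5, 0, 1, 6, 7] (by decide) 1 (by decide)
  have h3 := key ![1, 3, 5, 7, 0, 2, 4, 6] (by decide) 1 (by decide)
  have h4 := key ![1, 3, 4, 6, 0, 2, 5, 7] (by decide) 1 (by decide)
  have h5 := key ![1, 2, 5, 6, 0, 3, 4, 7] (by decide) 1 (by decide)
  have h6 := key ![1, 2, 4, 7, 0, 3, 5, 6] (by decide) 1 (by decide)
  have h7 := key ![0, 3, 5, 6, 1, 2, 4, 7] (by decide) 1 (by decide)
  have h8 := key ![0, 3, 4, 7, 1, 2, 5, 6] (by decide) 1 (by decide)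
  have h9 := key ![0, 2, 5, 7, 1, 3, 4, 6] (by decide) 1 (by decide)
  have h10 := key ![0, 2, 4, 6, 1, 3, 5, 7] (by decide) 1 (by decide)
  have h11 := key ![0, 1, 6, 7, 2, 3, 4, 5] (by decide) 1 (by decide)
  have h12 := key ![0, 1, 4, 5, 2, 3, 6, 7] (by decide) 1 (by decide)
  have h13 := key ![0, 1, 2, 3, 4, 5, 6, 7] (by decide) 1 (by decide)
  simp only [Matrix.cons_val] at h0 h1 h2 h3 h4 h5 h6 h7 h8 h9 h10 h11 h12 h13
  rw [h0, h1, h2, h3, h4, h5, h6, h7, h8, h9, h10, h11, h12, h13]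
  ring

end Forms

section Shuffles

lemma wedge_1_1 {f : (Fin 1 → E8) → ℝ} {g : (Fin 1 → E8) → ℝ} (hf : IsForm f)
    (hg : IsForm g) (v : Fin 2 → E8) :
    wedge f g v =
      f ![v 0] * g ![v 1] - f ![v 1] * g ![v 0] := by
  have hf' : ∀ x : Fin 1 → E8, f x = f ![x 0] :=
    fun x => congrArg f (by ext i; fin_cases i; rfl)
  have hg' : ∀ x : Fin 1 → E8, g x = g ![x 0] :=
    fun x => congrArg g (by ext i; fin_cases i; rfl)
  have := wedge_eq_sum_shuffles hf hg v
    (![![0, 1], ![1, 0]] :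
      Fin 2 → Fin 2 → Fin 2)
    (by decide) ![1, -1]
    (by decide) (by decide +kernel) (by decide)
  refine this.trans ?_
  rw [Finset.sum_congr rfl fun a _ => congrArg _ (congrArg₂ _ (hf' _) (hg' _))]
  simp [Fin.sum_univ_succ]
  ring

lemma wedge_2_2 {f : (Fin 2 → E8) → ℝ} {g : (Fin 2 → E8) → ℝ} (hf : IsForm f)
    (hg : IsForm g) (v : Fin 4 → E8) :
    wedge f g v =
      f ![v 0, v 1] * g ![v 2, v 3] - f ![v 0, v 2] * g ![v 1, v 3] +
      f ![v 0, v 3] * g ![v 1, v 2] + f ![v 1, v 2] * g ![v 0, v 3] -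
      f ![v 1, v 3] * g ![v 0, v 2] + f ![v 2, v 3] * g ![v 0, v 1] := by
  have hf' : ∀ x : Fin 2 → E8, f x = f ![x 0, x 1] :=
    fun x => congrArg f (by ext i; fin_cases i <;> rfl)
  have hg' : ∀ x : Fin 2 → E8, g x = g ![x 0, x 1] :=
    fun x => congrArg g (by ext i; fin_cases i <;> rfl)
  have := wedge_eq_sum_shuffles hf hg v
    (![![0, 1, 2, 3], ![0, 2, 1, 3], ![0, 3, 1, 2],
      ![1, 2, 0, 3], ![1, 3, 0, 2], ![2, 3, 0, 1]] :
      Fin 6 → Fin 4 → Fin 4)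
    (by decide) ![1, -1, 1, 1, -1, 1]
    (by decide) (by decide +kernel) (by decide)
  refine this.trans ?_
  rw [Finset.sum_congr rfl fun a _ => congrArg _ (congrArg₂ _ (hf' _) (hg' _))]
  simp [Fin.sum_univ_succ]
  ring

lemma wedge_3_3 {f : (Fin 3 → E8) → ℝ} {g : (Fin 3 → E8) → ℝ} (hf : IsForm f)
    (hg : IsForm g) (v : Fin 6 → E8) :
    wedge f g v =
      f ![v 0, v 1, v 2] * g ![v 3, v 4, v 5] - f ![v 0, v 1, v 3] * g ![v 2, v 4, v 5] +
      f ![v 0, v 1, v 4] * g ![v 2, v 3, v 5] - f ![v 0, v 1, v 5] * g ![v 2, v 3, v 4] +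
      f ![v 0, v 2, v 3] * g ![v 1, v 4, v 5] - f ![v 0, v 2, v 4] * g ![v 1, v 3, v 5] +
      f ![v 0, v 2, v 5] * g ![v 1, v 3, v 4] + f ![v 0, v 3, v 4] * g ![v 1, v 2, v 5] -
      f ![v 0, v 3, v 5] * g ![v 1, v 2, v 4] + f ![v 0, v 4, v 5] * g ![v 1, v 2, v 3] -
      f ![v 1, v 2, v 3] * g ![v 0, v 4, v 5] + f ![v 1, v 2, v 4] * g ![v 0, v 3, v 5] -
      f ![v 1, v 2, v 5] * g ![v 0, v 3, v 4] - f ![v 1, v 3, v 4] * g ![v 0, v 2, v 5] +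
      f ![v 1, v 3, v 5] * g ![v 0, v 2, v 4] - f ![v 1, v 4, v 5] * g ![v 0, v 2, v 3] +
      f ![v 2, v 3, v 4] * g ![v 0, v 1, v 5] - f ![v 2, v 3, v 5] * g ![v 0, v 1, v 4] +
      f ![v 2, v 4, v 5] * g ![v 0, v 1, v 3] - f ![v 3, v 4, v 5] * g ![v 0, v 1, v 2] := by
  have hf' : ∀ x : Fin 3 → E8, f x = f ![x 0, x 1, x 2] :=
    fun x => congrArg f (by ext i; fin_cases i <;> rfl)
  have hg' : ∀ x : Fin 3 → E8, g x = g ![x 0, x 1, x 2] :=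
    fun x => congrArg g (by ext i; fin_cases i <;> rfl)
  have := wedge_eq_sum_shuffles hf hg v
    (![![0, 1, 2, 3, 4, 5], ![0, 1, 3, 2, 4, 5], ![0, 1, 4, 2, 3, 5],
      ![0, 1, 5, 2, 3, 4], ![0, 2, 3, 1, 4, 5], ![0, 2, 4, 1, 3, 5],
      ![0, 2, 5, 1, 3, 4], ![0, 3, 4, 1, 2, 5], ![0, 3, 5, 1, 2, 4],
      ![0, 4, 5, 1, 2, 3], ![1, 2, 3, 0, 4, 5], ![1, 2, 4, 0, 3, 5],
      ![1, 2, 5, 0, 3, 4], ![1, 3, 4, 0, 2, 5], ![1, 3, 5, 0, 2, 4],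
      ![1, 4, 5, 0, 2, 3], ![2, 3, 4, 0, 1, 5], ![2, 3, 5, 0, 1, 4],
      ![2, 4, 5, 0, 1, 3], ![3, 4, 5, 0, 1, 2]] :
      Fin 20 → Fin 6 → Fin 6)
    (by decide) ![1, -1, 1, -1, 1, -1, 1, 1, -1, 1, -1, 1, -1, -1, 1, -1, 1, -1, 1, -1]
    (by decide) (by decide +kernel) (by decide)
  refine this.trans ?_
  rw [Finset.sum_congr rfl fun a _ => congrArg _ (congrArg₂ _ (hf' _) (hg' _))]
  simp [Fin.sum_univ_succ]
  ring

lemma wedge_2_6 {f : (Fin 2 → E8) → ℝ} {g : (Fin 6 → E8) → ℝ} (hf : IsForm f)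
    (hg : IsForm g) (v : Fin 8 → E8) :
    wedge f g v =
      f ![v 0, v 1] * g ![v 2, v 3, v 4, v 5, v 6, v 7] -
      f ![v 0, v 2] * g ![v 1, v 3, v 4, v 5, v 6, v 7] +
      f ![v 0, v 3] * g ![v 1, v 2, v 4, v 5, v 6, v 7] -
      f ![v 0, v 4] * g ![v 1, v 2, v 3, v 5, v 6, v 7] +
      f ![v 0, v 5] * g ![v 1, v 2, v 3, v 4, v 6, v 7] -
      f ![v 0, v 6] * g ![v 1, v 2, v 3, v 4, v 5, v 7] +
      f ![v 0, v 7] * g ![v 1, v 2, v 3, v 4, v 5, v 6] +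
      f ![v 1, v 2] * g ![v 0, v 3, v 4, v 5, v 6, v 7] -
      f ![v 1, v 3] * g ![v 0, v 2, v 4, v 5, v 6, v 7] +
      f ![v 1, v 4] * g ![v 0, v 2, v 3, v 5, v 6, v 7] -
      f ![v 1, v 5] * g ![v 0, v 2, v 3, v 4, v 6, v 7] +
      f ![v 1, v 6] * g ![v 0, v 2, v 3, v 4, v 5, v 7] -
      f ![v 1, v 7] * g ![v 0, v 2, v 3, v 4, v 5, v 6] +
      f ![v 2, v 3] * g ![v 0, v 1, v 4, v 5, v 6, v 7] -
      f ![v 2, v 4] * g ![v 0, v 1, v 3, v 5, v 6, v 7] +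
      f ![v 2, v 5] * g ![v 0, v 1, v 3, v 4, v 6, v 7] -
      f ![v 2, v 6] * g ![v 0, v 1, v 3, v 4, v 5, v 7] +
      f ![v 2, v 7] * g ![v 0, v 1, v 3, v 4, v 5, v 6] +
      f ![v 3, v 4] * g ![v 0, v 1, v 2, v 5, v 6, v 7] -
      f ![v 3, v 5] * g ![v 0, v 1, v 2, v 4, v 6, v 7] +
      f ![v 3, v 6] * g ![v 0, v 1, v 2, v 4, v 5, v 7] -
      f ![v 3, v 7] * g ![v 0, v 1, v 2, v 4, v 5, v 6] +
      f ![v 4, v 5] * g ![v 0, v 1, v 2, v 3, v 6, v 7] -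
      f ![v 4, v 6] * g ![v 0, v 1, v 2, v 3, v 5, v 7] +
      f ![v 4, v 7] * g ![v 0, v 1, v 2, v 3, v 5, v 6] +
      f ![v 5, v 6] * g ![v 0, v 1, v 2, v 3, v 4, v 7] -
      f ![v 5, v 7] * g ![v 0, v 1, v 2, v 3, v 4, v 6] +
      f ![v 6, v 7] * g ![v 0, v 1, v 2, v 3, v 4, v 5] := by
  have hf' : ∀ x : Fin 2 → E8, f x = f ![x 0, x 1] :=
    fun x => congrArg f (by ext i; fin_cases i <;> rfl)
  have hg' : ∀ x : Fin 6 → E8, g x = g ![x 0, x 1, x 2, x 3, x 4, x 5] :=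
    fun x => congrArg g (by ext i; fin_cases i <;> rfl)
  have := wedge_eq_sum_shuffles hf hg v
    (![![0, 1, 2, 3, 4, 5, 6, 7], ![0, 2, 1, 3, 4, 5, 6, 7], ![0, 3, 1, 2, 4, 5, 6, 7],
      ![0, 4, 1, 2, 3, 5, 6, 7], ![0, 5, 1, 2, 3, 4, 6, 7], ![0, 6, 1, 2, 3, 4, 5, 7],
      ![0, 7, 1, 2, 3, 4, 5, 6], ![1, 2, 0, 3, 4, 5, 6, 7], ![1, 3, 0, 2, 4, 5, 6, 7],
      ![1, 4, 0, 2, 3, 5, 6, 7], ![1, 5, 0, 2, 3, 4, 6, 7], ![1, 6, 0, 2, 3, 4, 5, 7],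
      ![1, 7, 0, 2, 3, 4, 5, 6], ![2, 3, 0, 1, 4, 5, 6, 7], ![2, 4, 0, 1, 3, 5, 6, 7],
      ![2, 5, 0, 1, 3, 4, 6, 7], ![2, 6, 0, 1, 3, 4, 5, 7], ![2, 7, 0, 1, 3, 4, 5, 6],
      ![3, 4, 0, 1, 2, 5, 6, 7], ![3, 5, 0, 1, 2, 4, 6, 7], ![3, 6, 0, 1, 2, 4, 5, 7],
      ![3, 7, 0, 1, 2, 4, 5, 6], ![4, 5, 0, 1, 2, 3, 6, 7], ![4, 6, 0, 1, 2, 3, 5, 7],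
      ![4, 7, 0, 1, 2, 3, 5, 6], ![5, 6, 0, 1, 2, 3, 4, 7], ![5, 7, 0, 1, 2, 3, 4, 6],
      ![6, 7, 0, 1, 2, 3, 4, 5]] :
      Fin 28 → Fin 8 → Fin 8)
    (by decide) ![1, -1, 1, -1, 1, -1, 1, 1, -1, 1, -1, 1, -1, 1, -1, 1,
      -1, 1, 1, -1, 1, -1, 1, -1, 1, 1, -1, 1]
    (by decide) (by decide +kernel) (by decide)
  refine this.trans ?_
  rw [Finset.sum_congr rfl fun a _ => congrArg _ (congrArg₂ _ (hf' _) (hg' _))]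
  simp [Fin.sum_univ_succ]
  ring


end Shuffles

section Coordinates

/-- The Plücker coordinates of the bivector `u ∧ v`. -/
def plucker (u v : E8) (i j : Fin 8) : ℝ := u i * v j - u j * v i

lemma dx4_eq_plucker (i j k l : Fin 8) (a b c d : E8) :
    dx4 i j k l ![a, b, c, d] =
      plucker a b i j * plucker c d k l - plucker a b i k * plucker c d j l +
      plucker a b i l * plucker c d j k + plucker a b j k * plucker c d i l -
      plucker a b j l * plucker c d i k + plucker a b k l * plucker c d i j := by
  simp [dx4, plucker, Matrix.det_succ_row_zero, Fin.sum_univ_succ, Fin.succAbove]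
  ring

lemma iota2_stdVec (u v : E8) :
    iota2 u v ![stdVec 0, stdVec 1] =
      -plucker u v 2 3 - plucker u v 4 5 - plucker u v 6 7 ∧
    iota2 u v ![stdVec 0, stdVec 2] =
      plucker u v 1 3 - plucker u v 4 6 + plucker u v 5 7 ∧
    iota2 u v ![stdVec 0, stdVec 3] =
      -plucker u v 1 2 + plucker u v 4 7 + plucker u v 5 6 ∧
    iota2 u v ![stdVec 0, stdVec 4] =
      plucker u v 1 5 + plucker u v 2 6 - plucker u v 3 7 ∧
    iota2 u v ![stdVec 0, stdVec 5] =
      -plucker u v 1 4 - plucker u v 2 7 - plucker u v 3 6 ∧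
    iota2 u v ![stdVec 0, stdVec 6] =
      plucker u v 1 7 - plucker u v 2 4 + plucker u v 3 5 ∧
    iota2 u v ![stdVec 0, stdVec 7] =
      -plucker u v 1 6 + plucker u v 2 5 + plucker u v 3 4 ∧
    iota2 u v ![stdVec 1, stdVec 2] =
      -plucker u v 0 3 + plucker u v 4 7 + plucker u v 5 6 ∧
    iota2 u v ![stdVec 1, stdVec 3] =
      plucker u v 0 2 + plucker u v 4 6 - plucker u v 5 7 ∧
    iota2 u v ![stdVec 1, stdVec 4] =
      -plucker u v 0 5 - plucker u v 2 7 - plucker u v 3 6 ∧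
    iota2 u v ![stdVec 1, stdVec 5] =
      plucker u v 0 4 - plucker u v 2 6 + plucker u v 3 7 ∧
    iota2 u v ![stdVec 1, stdVec 6] =
      -plucker u v 0 7 + plucker u v 2 5 + plucker u v 3 4 ∧
    iota2 u v ![stdVec 1, stdVec 7] =
      plucker u v 0 6 + plucker u v 2 4 - plucker u v 3 5 ∧
    iota2 u v ![stdVec 2, stdVec 3] =
      -plucker u v 0 1 - plucker u v 4 5 - plucker u v 6 7 ∧
    iota2 u v ![stdVec 2, stdVec 4] =
      -plucker u v 0 6 + plucker u v 1 7 + plucker u v 3 5 ∧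
    iota2 u v ![stdVec 2, stdVec 5] =
      plucker u v 0 7 + plucker u v 1 6 - plucker u v 3 4 ∧
    iota2 u v ![stdVec 2, stdVec 6] =
      plucker u v 0 4 - plucker u v 1 5 + plucker u v 3 7 ∧
    iota2 u v ![stdVec 2, stdVec 7] =
      -plucker u v 0 5 - plucker u v 1 4 - plucker u v 3 6 ∧
    iota2 u v ![stdVec 3, stdVec 4] =
      plucker u v 0 7 + plucker u v 1 6 - plucker u v 2 5 ∧
    iota2 u v ![stdVec 3, stdVec 5] =
      plucker u v 0 6 - plucker u v 1 7 + plucker u v 2 4 ∧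
    iota2 u v ![stdVec 3, stdVec 6] =
      -plucker u v 0 5 - plucker u v 1 4 - plucker u v 2 7 ∧
    iota2 u v ![stdVec 3, stdVec 7] =
      -plucker u v 0 4 + plucker u v 1 5 + plucker u v 2 6 ∧
    iota2 u v ![stdVec 4, stdVec 5] =
      -plucker u v 0 1 - plucker u v 2 3 - plucker u v 6 7 ∧
    iota2 u v ![stdVec 4, stdVec 6] =
      -plucker u v 0 2 + plucker u v 1 3 + plucker u v 5 7 ∧
    iota2 u v ![stdVec 4, stdVec 7] =
      plucker u v 0 3 + plucker u v 1 2 - plucker u v 5 6 ∧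
    iota2 u v ![stdVec 5, stdVec 6] =
      plucker u v 0 3 + plucker u v 1 2 - plucker u v 4 7 ∧
    iota2 u v ![stdVec 5, stdVec 7] =
      plucker u v 0 2 - plucker u v 1 3 + plucker u v 4 6 ∧
    iota2 u v ![stdVec 6, stdVec 7] =
      -plucker u v 0 1 - plucker u v 2 3 - plucker u v 4 5 := by
  have swap : ∀ i j, plucker v u i j = -plucker u v i j := fun i j => by
    simp only [plucker]; ring
  and_intros <;>
    simp [iota2, Phi0, dx4_eq_plucker, swap, plucker.eq_def (stdVec _), stdVec_apply] <;> ring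

lemma iota1_stdVec (y : E8) :
    iota1 y ![stdVec 0, stdVec 1, stdVec 2] = -y 3 ∧
    iota1 y ![stdVec 0, stdVec 1, stdVec 3] = y 2 ∧
    iota1 y ![stdVec 0, stdVec 1, stdVec 4] = -y 5 ∧
    iota1 y ![stdVec 0, stdVec 1, stdVec 5] = y 4 ∧
    iota1 y ![stdVec 0, stdVec 1, stdVec 6] = -y 7 ∧
    iota1 y ![stdVec 0, stdVec 1, stdVec 7] = y 6 ∧
    iota1 y ![stdVec 0, stdVec 2, stdVec 3] = -y 1 ∧
    iota1 y ![stdVec 0, stdVec 2, stdVec 4] = -y 6 ∧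
    iota1 y ![stdVec 0, stdVec 2, stdVec 5] = y 7 ∧
    iota1 y ![stdVec 0, stdVec 2, stdVec 6] = y 4 ∧
    iota1 y ![stdVec 0, stdVec 2, stdVec 7] = -y 5 ∧
    iota1 y ![stdVec 0, stdVec 3, stdVec 4] = y 7 ∧
    iota1 y ![stdVec 0, stdVec 3, stdVec 5] = y 6 ∧
    iota1 y ![stdVec 0, stdVec 3, stdVec 6] = -y 5 ∧
    iota1 y ![stdVec 0, stdVec 3, stdVec 7] = -y 4 ∧
    iota1 y ![stdVec 0, stdVec 4, stdVec 5] = -y 1 ∧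
    iota1 y ![stdVec 0, stdVec 4, stdVec 6] = -y 2 ∧
    iota1 y ![stdVec 0, stdVec 4, stdVec 7] = y 3 ∧
    iota1 y ![stdVec 0, stdVec 5, stdVec 6] = y 3 ∧
    iota1 y ![stdVec 0, stdVec 5, stdVec 7] = y 2 ∧
    iota1 y ![stdVec 0, stdVec 6, stdVec 7] = -y 1 ∧
    iota1 y ![stdVec 1, stdVec 2, stdVec 3] = y 0 ∧
    iota1 y ![stdVec 1, stdVec 2, stdVec 4] = y 7 ∧
    iota1 y ![stdVec 1, stdVec 2, stdVec 5] = y 6 ∧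
    iota1 y ![stdVec 1, stdVec 2, stdVec 6] = -y 5 ∧
    iota1 y ![stdVec 1, stdVec 2, stdVec 7] = -y 4 ∧
    iota1 y ![stdVec 1, stdVec 3, stdVec 4] = y 6 ∧
    iota1 y ![stdVec 1, stdVec 3, stdVec 5] = -y 7 ∧
    iota1 y ![stdVec 1, stdVec 3, stdVec 6] = -y 4 ∧
    iota1 y ![stdVec 1, stdVec 3, stdVec 7] = y 5 ∧
    iota1 y ![stdVec 1, stdVec 4, stdVec 5] = y 0 ∧
    iota1 y ![stdVec 1, stdVec 4, stdVec 6] = y 3 ∧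
    iota1 y ![stdVec 1, stdVec 4, stdVec 7] = y 2 ∧
    iota1 y ![stdVec 1, stdVec 5, stdVec 6] = y 2 ∧
    iota1 y ![stdVec 1, stdVec 5, stdVec 7] = -y 3 ∧
    iota1 y ![stdVec 1, stdVec 6, stdVec 7] = y 0 ∧
    iota1 y ![stdVec 2, stdVec 3, stdVec 4] = -y 5 ∧
    iota1 y ![stdVec 2, stdVec 3, stdVec 5] = y 4 ∧
    iota1 y ![stdVec 2, stdVec 3, stdVec 6] = -y 7 ∧
    iota1 y ![stdVec 2, stdVec 3, stdVec 7] = y 6 ∧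
    iota1 y ![stdVec 2, stdVec 4, stdVec 5] = -y 3 ∧
    iota1 y ![stdVec 2, stdVec 4, stdVec 6] = y 0 ∧
    iota1 y ![stdVec 2, stdVec 4, stdVec 7] = -y 1 ∧
    iota1 y ![stdVec 2, stdVec 5, stdVec 6] = -y 1 ∧
    iota1 y ![stdVec 2, stdVec 5, stdVec 7] = -y 0 ∧
    iota1 y ![stdVec 2, stdVec 6, stdVec 7] = -y 3 ∧
    iota1 y ![stdVec 3, stdVec 4, stdVec 5] = y 2 ∧
    iota1 y ![stdVec 3, stdVec 4, stdVec 6] = -y 1 ∧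
    iota1 y ![stdVec 3, stdVec 4, stdVec 7] = -y 0 ∧
    iota1 y ![stdVec 3, stdVec 5, stdVec 6] = -y 0 ∧
    iota1 y ![stdVec 3, stdVec 5, stdVec 7] = y 1 ∧
    iota1 y ![stdVec 3, stdVec 6, stdVec 7] = y 2 ∧
    iota1 y ![stdVec 4, stdVec 5, stdVec 6] = -y 7 ∧
    iota1 y ![stdVec 4, stdVec 5, stdVec 7] = y 6 ∧
    iota1 y ![stdVec 4, stdVec 6, stdVec 7] = -y 5 ∧
    iota1 y ![stdVec 5, stdVec 6, stdVec 7] = y 4 := by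
  and_intros <;>
    simp [iota1, Phi0, dx4_eq_plucker, plucker, stdVec_apply]

lemma flat_stdVec (u : E8) (i : Fin 8) : flat u ![stdVec i] = u i := by
  simp [flat, stdVec, EuclideanSpace.inner_single_right]

lemma wedge_flat_stdVec (u v : E8) (i j : Fin 8) :
    wedge (flat u) (flat v) ![stdVec i, stdVec j] = plucker u v i j := by
  rw [wedge_1_1 (isForm_flat u) (isForm_flat v)]
  simp [flat_stdVec, plucker]

end Coordinates

/-- For a Cayley-free 4-frame `u, v, y, w ∈ ℝ⁸` (i.e. `Φ₀(u,v,y,w) = 0`),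
with `A = ⟨u,y⟩⟨v,w⟩ − ⟨u,w⟩⟨v,y⟩`, one has `(ι_uι_vΦ₀) ∧ (y♭∧w♭) ∧ Φ₀ = −3A·vol`,
`(u♭∧v♭) ∧ (ι_yΦ₀) ∧ (ι_wΦ₀) = −4A·vol` and `(ι_uι_vΦ₀) ∧ (ι_yι_wΦ₀) ∧ Φ₀ = 6A·vol`. -/
theorem cayley_free_frame_wedge_identities (u v y w : E8)
    (hB : Phi0 ![u, v, y, w] = 0) :
    (∀ vv : Fin 8 → E8,
      wedge (wedge (iota2 u v) (wedge (flat y) (flat w))) Phi0 vv =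
        -3 * (⟪u, y⟫ * ⟪v, w⟫ - ⟪u, w⟫ * ⟪v, y⟫) * vol vv) ∧
    (∀ vv : Fin 8 → E8,
      wedge (wedge (flat u) (flat v)) (wedge (iota1 y) (iota1 w)) vv =
        -4 * (⟪u, y⟫ * ⟪v, w⟫ - ⟪u, w⟫ * ⟪v, y⟫) * vol vv) ∧
    (∀ vv : Fin 8 → E8,
      wedge (wedge (iota2 u v) (iota2 y w)) Phi0 vv =
        6 * (⟪u, y⟫ * ⟪v, w⟫ - ⟪u, w⟫ * ⟪v, y⟫) * vol vv) := by
  have hA : ⟪u, y⟫ * ⟪v, w⟫ - ⟪u, w⟫ * ⟪v, y⟫ =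
      ∑ i, ∑ j, if i < j then plucker u v i j * plucker y w i j else 0 := by
    simp [PiLp.inner_apply, Fin.sum_univ_eight, plucker]
    ring
  simp [Fin.sum_univ_eight] at hA
  have h2 := isForm_iota2 u v
  have h2' := isForm_iota2 y w
  have hf := (isForm_flat y).wedge (isForm_flat w)
  have hf' := (isForm_flat u).wedge (isForm_flat v)
  have h6 := (isForm_iota1 y).wedge (isForm_iota1 w)
  simp only [Phi0, dx4_eq_plucker] at hB
  refine ⟨fun vv => ?_, fun vv => ?_, fun vv => ?_⟩
  · rw [((h2.wedge hf).wedge isForm_Phi0).eq_mul_vol vv, wedge_Phi0_stdVec (h2.wedge hf), hA]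
    congr 1
    simp only [wedge_2_2 h2 hf, Matrix.cons_val, iota2_stdVec u v, wedge_flat_stdVec y w]
    linear_combination (-2) * hB
  · rw [(hf'.wedge h6).eq_mul_vol vv, wedge_2_6 hf' h6, hA]
    congr 1
    simp only [wedge_3_3 (isForm_iota1 y) (isForm_iota1 w), Matrix.cons_val, iota1_stdVec y,
      iota1_stdVec w, wedge_flat_stdVec u v, plucker.eq_def y w] at hB ⊢
    linear_combination 2 * hB
  · rw [((h2.wedge h2').wedge isForm_Phi0).eq_mul_vol vv, wedge_Phi0_stdVec (h2.wedge h2'), hA]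
    congr 1
    simp only [wedge_2_2 h2 h2', Matrix.cons_val, iota2_stdVec u v, iota2_stdVec y w]
    linear_combination 7 * hB
end
end

section
/- Every linear subspace W ⊆ ℝ⁸ with dim W ≥ 5 contains a Cayley plane, i.e. there exist orthonormal vectors x₁, x₂, x₃, x₄ ∈ W with Φ₀(x₁, x₂, x₃, x₄) = 1. Combined with the existence of a 4-dimensional Φ₀-free subspace, this shows that the free dimension of the Cayley calibration satisfies fd(Φ₀) = 4. -/
noncomputable section
open scoped RealInnerProductSpace

/-- A Cayley plane: a 4-dimensional subspace of ℝ⁸ admitting an orthonormal basis on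
which `Φ₀` evaluates to `1`. -/
def IsCayleyPlane (ξ : Submodule ℝ E8) : Prop :=
  ∃ x : Fin 4 → E8, Orthonormal ℝ x ∧ Submodule.span ℝ (Set.range x) = ξ ∧ Phi0 x = 1

/-- The coordinate minor of `x, y, z` in the coordinates `i, j, k`. -/
def minor3 (x y z : E8) (i j k : Fin 8) : ℝ :=
  x i * (y j * z k - y k * z j) - x j * (y i * z k - y k * z i) + x k * (y i * z j - y j * z i)

/-- The triple cross product on ℝ⁸, dual to `Phi0` in its last argument. -/
def cross3 (x y z : E8) : E8 :=
  let m := minor3 x y z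
  !₂[
    m 2 5 7 + m 3 4 7 + m 3 5 6 - m 1 2 3
      - m 1 4 5 - m 1 6 7 - m 2 4 6,
    m 0 2 3 + m 0 4 5 + m 0 6 7 + m 2 4 7
      + m 2 5 6 + m 3 4 6 - m 3 5 7,
    m 0 4 6 - m 0 1 3 - m 0 5 7 - m 1 4 7
      - m 1 5 6 - m 3 4 5 - m 3 6 7,
    m 0 1 2 + m 1 5 7 + m 2 4 5 + m 2 6 7
      - m 0 4 7 - m 0 5 6 - m 1 4 6,
    m 0 3 7 + m 1 2 7 + m 1 3 6 - m 0 1 5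
      - m 0 2 6 - m 2 3 5 - m 5 6 7,
    m 0 1 4 + m 0 2 7 + m 0 3 6 + m 1 2 6
      + m 2 3 4 + m 4 6 7 - m 1 3 7,
    m 0 2 4 - m 0 1 7 - m 0 3 5 - m 1 2 5
      - m 1 3 4 - m 2 3 7 - m 4 5 7,
    m 0 1 6 + m 1 3 5 + m 2 3 6 + m 4 5 6
      - m 0 2 5 - m 0 3 4 - m 1 2 4]

theorem inner_eq_sum (x y : E8) : ⟪x, y⟫ = x 0 * y 0 + x 1 * y 1 + x 2 * y 2 + x 3 * y 3 +
    x 4 * y 4 + x 5 * y 5 + x 6 * y 6 + x 7 * y 7 := by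
  simp [PiLp.inner_apply, Fin.sum_univ_eight, mul_comm]

theorem dx4_eq (i j k l : Fin 8) (x y z w : E8) :
    dx4 i j k l ![x, y, z, w] = w l * minor3 x y z i j k - w k * minor3 x y z i j l
      + w j * minor3 x y z i k l - w i * minor3 x y z j k l := by
  simp only [dx4, minor3, Matrix.det_succ_row_zero, Fin.sum_univ_succ]
  simp [Fin.succAbove, Matrix.submatrix]
  ring

theorem inner_cross3 (x y z w : E8) : ⟪cross3 x y z, w⟫ = Phi0 ![x, y, z, w] := by
  simp only [Phi0, dx4_eq, inner_eq_sum]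
  simp [cross3]
  ring

theorem cross3_swap_left (x y z : E8) : cross3 y x z = -cross3 x y z := by
  ext i
  fin_cases i <;> simp [cross3, minor3] <;> ring

theorem cross3_swap_right (x y z : E8) : cross3 x z y = -cross3 x y z := by
  ext i
  fin_cases i <;> simp [cross3, minor3] <;> ring

theorem cross3_add_right (x y z w : E8) : cross3 x y (z + w) = cross3 x y z + cross3 x y w := by
  ext i
  fin_cases i <;> simp [cross3, minor3] <;> ring

theorem cross3_smul_right (r : ℝ) (x y z : E8) : cross3 x y (r • z) = r • cross3 x y z := by
  ext i
  fin_cases i <;> simp [cross3, minor3] <;> ring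

theorem inner_cross3_swap (x y z w : E8) : ⟪cross3 x y z, w⟫ = -⟪cross3 x y w, z⟫ := by
  simp only [inner_eq_sum]
  simp [cross3, minor3]
  ring

set_option maxHeartbeats 1000000 in
theorem cross3_cross3 (x u v : E8) : cross3 x u (cross3 x u v) =
    (⟪x, u⟫ ^ 2 - ⟪x, x⟫ * ⟪u, u⟫) • v + (⟪x, x⟫ * ⟪u, v⟫ - ⟪x, u⟫ * ⟪x, v⟫) • u
      + (⟪u, u⟫ * ⟪x, v⟫ - ⟪x, u⟫ * ⟪u, v⟫) • x := by
  simp only [inner_eq_sum]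
  ext i
  fin_cases i <;> simp [cross3, minor3] <;> ring

theorem cross3_neg_right (x y z : E8) : cross3 x y (-z) = -cross3 x y z := by
  simpa using cross3_smul_right (-1) x y z

theorem inner_cross3_right (x y z : E8) : ⟪cross3 x y z, z⟫ = 0 :=
  self_eq_neg.1 (inner_cross3_swap x y z z)

theorem inner_cross3_middle (x y z : E8) : ⟪cross3 x y z, y⟫ = 0 := by
  rw [← neg_eq_zero, ← inner_neg_left, ← cross3_swap_right, inner_cross3_right]

theorem inner_cross3_left (x y z : E8) : ⟪cross3 x y z, x⟫ = 0 := by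
  rw [← neg_eq_zero, ← inner_neg_left, ← cross3_swap_left, inner_cross3_middle]

theorem cross3_cross3_self {x u v : E8} (hxu : ⟪x, u⟫ = 0) (hxv : ⟪x, v⟫ = 0) (huv : ⟪u, v⟫ = 0) :
    cross3 x u (cross3 x u v) = -(⟪x, x⟫ * ⟪u, u⟫) • v := by
  simp [cross3_cross3, hxu, hxv, huv]

/-- On the orthogonal complement of `x`, iterated cross products of orthogonal vectors
anticommute. -/
theorem cross3_cross3_swap {x u v w : E8} (hxu : ⟪x, u⟫ = 0) (hxv : ⟪x, v⟫ = 0) (hxw : ⟪x, w⟫ = 0)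
    (huv : ⟪u, v⟫ = 0) (huw : ⟪u, w⟫ = 0) (hvw : ⟪v, w⟫ = 0) :
    cross3 x u (cross3 x v w) = -cross3 x v (cross3 x u w) := by
  have hadd (s t r : E8) : cross3 x (s + t) r = cross3 x s r + cross3 x t r := by
    rw [← neg_inj, ← cross3_swap_right, cross3_add_right, cross3_swap_right x s,
      cross3_swap_right x t, neg_add]
  have h := cross3_cross3_self (x := x) (u := u + v) (v := w) (by simp [inner_add_right, hxu, hxv])
    hxw (by simp [inner_add_left, huw, hvw])
  simp only [hadd, cross3_add_right, cross3_cross3_self hxu hxw huw,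
    cross3_cross3_self hxv hxw hvw] at h
  rw [inner_add_left, inner_add_right, inner_add_right, huv, real_inner_comm u v, huv] at h
  rw [← sub_eq_zero] at h ⊢
  rw [← h]
  module

theorem inner_cross3_cross3 {x y : E8} (u : E8) {v : E8} (hx : ⟪x, x⟫ = 1) (hy : ⟪y, y⟫ = 1)
    (hxy : ⟪x, y⟫ = 0) (hxu : ⟪x, u⟫ = 0) (hyu : ⟪y, u⟫ = 0) :
    ⟪cross3 x y u, cross3 x y v⟫ = ⟪u, v⟫ := by
  rw [real_inner_comm, inner_cross3_swap, cross3_cross3_self hxy hxu hyu, hx, hy]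
  simp

theorem cross3_rotate (x y z : E8) : cross3 x y z = cross3 y z x := by
  rw [cross3_swap_right y x z, cross3_swap_left x y, neg_neg]

/-- The orthogonal complement of an orthonormal triple contains a Cayley quadruple. -/
theorem exists_orthonormal_Phi0_eq_one {a b c : E8} (haa : ⟪a, a⟫ = 1) (hbb : ⟪b, b⟫ = 1)
    (hcc : ⟪c, c⟫ = 1) (hab : ⟪a, b⟫ = 0) (hac : ⟪a, c⟫ = 0) (hbc : ⟪b, c⟫ = 0) :
    ∃ x : Fin 4 → E8, (∀ i, ⟪x i, a⟫ = 0 ∧ ⟪x i, b⟫ = 0 ∧ ⟪x i, c⟫ = 0) ∧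
      Orthonormal ℝ x ∧ Phi0 x = 1 := by
  obtain ⟨x, hxx, hx⟩ : ∃ x : E8, ⟪x, x⟫ = 1 ∧ ∀ i, ⟪x, ![a, b, c, cross3 a b c] i⟫ = 0 := by
    let U := Submodule.span ℝ (Set.range ![a, b, c, cross3 a b c])
    have hle : Module.finrank ℝ U ≤ 4 := finrank_range_le_card (R := ℝ) ![a, b, c, cross3 a b c]
    have hsum := U.finrank_add_finrank_orthogonal
    rw [finrank_euclideanSpace_fin] at hsum
    have hpos : 0 < Module.finrank ℝ Uᗮ := by omega
    have := Module.finrank_pos_iff.1 hpos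
    obtain ⟨y, hy⟩ := exists_norm_eq Uᗮ zero_le_one
    refine ⟨y, ?_, fun i ↦ ?_⟩
    · rw [real_inner_self_eq_norm_sq, Submodule.norm_coe, hy, one_pow]
    · exact (Submodule.mem_orthogonal' _ _).1 y.2 _ (Submodule.subset_span ⟨i, rfl⟩)
  have hxa : ⟪x, a⟫ = 0 := hx 0
  have hxb : ⟪x, b⟫ = 0 := hx 1
  have hxc : ⟪x, c⟫ = 0 := hx 2
  have hxd : ⟪x, cross3 a b c⟫ = 0 := hx 3
  have hba : ⟪b, a⟫ = 0 := by rw [real_inner_comm, hab]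
  have hca : ⟪c, a⟫ = 0 := by rw [real_inner_comm, hac]
  have hcb : ⟪c, b⟫ = 0 := by rw [real_inner_comm, hbc]
  have habc : ⟪cross3 x a b, c⟫ = 0 := by
    rw [cross3_rotate, inner_cross3_swap, real_inner_comm, hxd, neg_zero]
  have hbca : ⟪cross3 x b c, a⟫ = 0 := by
    rw [inner_cross3_swap, cross3_swap_right, inner_neg_left, habc]; simp
  have hcab : ⟪cross3 x c a, b⟫ = 0 := by
    rw [inner_cross3_swap, cross3_swap_right, inner_neg_left, hbca]; simp
  have hAA : ⟪cross3 x a b, cross3 x a b⟫ = 1 := by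
    rw [inner_cross3_cross3 b hxx haa hxa hxb hab, hbb]
  have hBB : ⟪cross3 x b c, cross3 x b c⟫ = 1 := by
    rw [inner_cross3_cross3 c hxx hbb hxb hxc hbc, hcc]
  have hCC : ⟪cross3 x c a, cross3 x c a⟫ = 1 := by
    rw [inner_cross3_cross3 a hxx hcc hxc hxa hca, haa]
  have hBA : ⟪cross3 x b c, cross3 x a b⟫ = 0 := by
    rw [cross3_swap_right x b a, inner_neg_right, inner_cross3_cross3 c hxx hbb hxb hxc hbc, hca,
      neg_zero]
  have hBC : ⟪cross3 x b c, cross3 x c a⟫ = 0 := by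
    rw [cross3_swap_right x c b, inner_neg_left, inner_cross3_cross3 b hxx hcc hxc hxb hcb, hba,
      neg_zero]
  have hAC : ⟪cross3 x a b, cross3 x c a⟫ = 0 := by
    rw [cross3_swap_right x a c, inner_neg_right, inner_cross3_cross3 b hxx haa hxa hxb hab, hbc,
      neg_zero]
  have hx0 (y z : E8) : ⟪x, cross3 x y z⟫ = 0 := by rw [real_inner_comm, inner_cross3_left]
  have key : cross3 x (cross3 x b c) (cross3 x a b) = cross3 x c a := by
    have h1 : cross3 x (cross3 x a b) (cross3 x b c)
        = -cross3 x b (cross3 x (cross3 x a b) c) :=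
      cross3_cross3_swap (hx0 _ _) hxb hxc (inner_cross3_right _ _ _) habc hbc
    have h2 : cross3 x c (cross3 x a b) = -cross3 x a (cross3 x c b) :=
      cross3_cross3_swap hxc hxa hxb hca hcb hab
    have h3 : cross3 x a (cross3 x b c) = -cross3 x b (cross3 x a c) :=
      cross3_cross3_swap hxa hxb hxc hab hac hbc
    have h4 : cross3 x b (cross3 x b (cross3 x c a)) = -cross3 x c a := by
      rw [cross3_cross3_self hxb (hx0 _ _) (by rw [real_inner_comm, hcab]), hxx, hbb]
      simp
    rw [cross3_swap_right, h1, neg_neg, cross3_swap_right x c, cross3_neg_right, h2,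
      cross3_swap_right x b c]
    simp only [cross3_neg_right, neg_neg, h3, cross3_swap_right x c a, h4]
  refine ⟨![x, cross3 x b c, cross3 x a b, cross3 x c a], ?_, ?_, ?_⟩
  · intro i
    fin_cases i <;>
      simp [hxa, hxb, hxc, habc, hbca, hcab, inner_cross3_middle, inner_cross3_right]
  · rw [orthonormal_iff_ite]
    intro i j
    fin_cases i <;> fin_cases j <;>
      simp [hxx, hAA, hBB, hCC, hBA, hBC, hAC, hx0, inner_cross3_left, -inner_self_eq_norm_sq_to_K,
        real_inner_comm (cross3 x b c) (cross3 x a b), real_inner_comm (cross3 x b c) (cross3 x c a),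
        real_inner_comm (cross3 x a b) (cross3 x c a)]
  · rw [← inner_cross3, key, hCC]

theorem exists_Phi0_eq_one_of_five_le_finrank {W : Submodule ℝ E8} (hW : 5 ≤ Module.finrank ℝ W) :
    ∃ x : Fin 4 → E8, (∀ i, x i ∈ W) ∧ Orthonormal ℝ x ∧ Phi0 x = 1 := by
  obtain ⟨V, hVW, hV⟩ : ∃ V ≤ W, Module.finrank ℝ V = 5 := by
    obtain ⟨f, hf⟩ := exists_linearIndependent_of_le_finrank hW
    refine ⟨(Submodule.span ℝ (Set.range f)).map W.subtype, W.map_subtype_le _, ?_⟩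
    rw [Submodule.finrank_map_subtype_eq, finrank_span_eq_card hf, Fintype.card_fin]
  have hVo : Module.finrank ℝ Vᗮ = 3 := by
    have := V.finrank_add_finrank_orthogonal
    rw [finrank_euclideanSpace_fin] at this
    omega
  let e := (stdOrthonormalBasis ℝ Vᗮ).reindex (finCongr hVo)
  have he (i j : Fin 3) : ⟪(e i : E8), (e j : E8)⟫ = if i = j then 1 else 0 :=
    orthonormal_iff_ite.1 e.orthonormal i j
  obtain ⟨x, hx, hon, hphi⟩ := exists_orthonormal_Phi0_eq_one (he 0 0) (he 1 1) (he 2 2)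
    (he 0 1) (he 0 2) (he 1 2)
  refine ⟨x, fun i ↦ hVW ?_, hon, hphi⟩
  rw [← V.orthogonal_orthogonal, Submodule.mem_orthogonal]
  intro u hu
  have hu' := congrArg Subtype.val (e.sum_repr ⟨u, hu⟩)
  simp only [Fin.sum_univ_three, Submodule.coe_add, Submodule.coe_smul] at hu'
  obtain ⟨h0, h1, h2⟩ := hx i
  rw [← hu', real_inner_comm]
  simp only [inner_add_right, real_inner_smul_right, h0, h1, h2, mul_zero, add_zero]

theorem Phi0_eq_zero_of_coord_eq_zero (x : Fin 4 → E8)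
    (hx : ∀ i, x i 3 = 0 ∧ x i 5 = 0 ∧ x i 6 = 0 ∧ x i 7 = 0) : Phi0 x = 0 := by
  have hdx (i j k l : Fin 8) (a : Fin 4) (h : ∀ b, x b (![i, j, k, l] a) = 0) :
      dx4 i j k l x = 0 := Matrix.det_eq_zero_of_row_eq_zero a h
  have h3 b := (hx b).1
  have h5 b := (hx b).2.1
  have h6 b := (hx b).2.2.1
  have h7 b := (hx b).2.2.2
  simp only [Phi0]
  rw [hdx 0 1 2 3 3 h3, hdx 0 1 4 5 3 h5, hdx 0 1 6 7 3 h7, hdx 0 2 4 6 3 h6, hdx 0 2 5 7 3 h7,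
    hdx 0 3 4 7 3 h7, hdx 0 3 5 6 3 h6, hdx 1 2 4 7 3 h7, hdx 1 2 5 6 3 h6, hdx 1 3 4 6 3 h6,
    hdx 1 3 5 7 3 h7, hdx 2 3 4 5 3 h5, hdx 2 3 6 7 3 h7, hdx 4 5 6 7 3 h7]
  simp

theorem exists_finrank_eq_four_no_cayley : ∃ W : Submodule ℝ E8, Module.finrank ℝ W = 4 ∧
    ∀ ξ : Submodule ℝ E8, IsCayleyPlane ξ → ¬ ξ ≤ W := by
  let f (i : Fin 4) : E8 := EuclideanSpace.single (![0, 1, 2, 4] i) 1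
  refine ⟨Submodule.span ℝ (Set.range f), ?_, ?_⟩
  · have hf : LinearIndependent ℝ f :=
      (EuclideanSpace.orthonormal_single.comp ![0, 1, 2, 4] (by decide)).linearIndependent
    simpa using finrank_span_eq_card hf
  · rintro ξ ⟨x, -, rfl, hphi⟩ hle
    have hcoord (k : Fin 8) (hk : ∀ i, ![0, 1, 2, 4] i ≠ k) (b : Fin 4) : x b k = 0 := by
      have hmem := hle (Submodule.subset_span ⟨b, rfl⟩)
      have hker : Submodule.span ℝ (Set.range f) ≤ LinearMap.ker 
          (EuclideanSpace.proj k : E8 →L[ℝ] ℝ).toLinearMap := by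
        rw [Submodule.span_le]
        rintro _ ⟨i, rfl⟩
        simp [f, (hk i).symm]
      exact hker hmem
    rw [Phi0_eq_zero_of_coord_eq_zero x fun b ↦ ⟨hcoord 3 (by decide) b, hcoord 5 (by decide) b,
      hcoord 6 (by decide) b, hcoord 7 (by decide) b⟩] at hphi
    exact zero_ne_one hphi

/-- Every linear subspace of ℝ⁸ of dimension at least 5 contains a
Cayley plane (orthonormal vectors `x₁, x₂, x₃, x₄` with `Φ₀(x₁,x₂,x₃,x₄) = 1`);
consequently the free dimension of the Cayley calibration is `fd(Φ₀) = 4`, i.e. `4`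
is the greatest dimension of a subspace of ℝ⁸ containing no Cayley plane. -/
theorem free_dimension_of_cayley_calibration :
    (∀ W : Submodule ℝ E8, 5 ≤ Module.finrank ℝ W →
      ∃ x : Fin 4 → E8, (∀ i, x i ∈ W) ∧ Orthonormal ℝ x ∧ Phi0 x = 1) ∧
    IsGreatest {n : ℕ | ∃ W : Submodule ℝ E8, Module.finrank ℝ W = n ∧
      ∀ ξ : Submodule ℝ E8, IsCayleyPlane ξ → ¬ ξ ≤ W} 4 := by
  refine ⟨fun W hW ↦ exists_Phi0_eq_one_of_five_le_finrank hW, exists_finrank_eq_four_no_cayley, ?_⟩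
  rintro n ⟨W, rfl, hW⟩
  by_contra! h
  obtain ⟨x, hx, hon, hphi⟩ := exists_Phi0_eq_one_of_five_le_finrank h
  refine hW _ ⟨x, hon, rfl, hphi⟩ (Submodule.span_le.2 ?_)
  rintro _ ⟨i, rfl⟩
  exact hx i
end
end
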